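/- For ũ₁ ∈ ℝ, the contour integrals φ_{±,0} and φ_{±,1} have the closed forms φ_{±,0} = ±½ + (i/√(2π)) ∫₀^{ũ₁} e^{s²/2} ds and φ_{±,1} = ±ũ₁/2 + (i/√(2π)) ( ũ₁ ∫₀^{ũ₁} e^{s²/2} ds − e^{ũ₁²/2} ). -/

import Mathlib

open MeasureTheory Real Complex

noncomputable section

/-- `φ_{+,j}(ε)`: the contour integral `−(1/2πi)∫_{Γ₊} s^{−j−1} e^{−s²/2+ũ₁s} ds`, where the
origin is avoided by a semicircle of radius `ε` in the upper half-plane (parametrized by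
`s = εe^{iθ}`, `θ` from `π` to `0`). -/
def phiP (u : ℝ) (j : ℕ) (ε : ℝ) : ℂ :=
  -(1 / (2 * (π : ℂ) * I)) *
    ((∫ s in Set.Iio (-ε), Real.exp (-s ^ 2 / 2 + u * s) / s ^ (j + 1) : ℝ)
      + (∫ θ in (π : ℝ)..0, I * (ε : ℂ) ^ (-(j : ℤ)) * Complex.exp (-I * j * θ) *
          Complex.exp (-(ε : ℂ) ^ 2 * Complex.exp (2 * I * θ) / 2
            + (u : ℂ) * ε * Complex.exp (I * θ)))
      + (∫ s in Set.Ioi ε, Real.exp (-s ^ 2 / 2 + u * s) / s ^ (j + 1) : ℝ))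

/-- `φ_{−,j}(ε)`: the same with the semicircle in the lower half-plane (`θ` from `π` to `2π`). -/
def phiM (u : ℝ) (j : ℕ) (ε : ℝ) : ℂ :=
  -(1 / (2 * (π : ℂ) * I)) *
    ((∫ s in Set.Iio (-ε), Real.exp (-s ^ 2 / 2 + u * s) / s ^ (j + 1) : ℝ)
      + (∫ θ in (π : ℝ)..(2 * π), I * (ε : ℂ) ^ (-(j : ℤ)) * Complex.exp (-I * j * θ) *
          Complex.exp (-(ε : ℂ) ^ 2 * Complex.exp (2 * I * θ) / 2
            + (u : ℂ) * ε * Complex.exp (I * θ)))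
      + (∫ s in Set.Ioi ε, Real.exp (-s ^ 2 / 2 + u * s) / s ^ (j + 1) : ℝ))


lemma integrable_exp_neg_sq_div_two_add (u : ℝ) :
    Integrable fun s : ℝ => Real.exp (-s ^ 2 / 2 + u * s) := by
  have h := ((integrable_exp_neg_mul_sq (b := 1 / 2) (by norm_num)).comp_sub_right u).const_mul
    (Real.exp (u ^ 2 / 2))
  refine h.congr (ae_of_all _ fun s => ?_)
  simp only [← Real.exp_add]
  congr 1
  ring

lemma integral_exp_neg_sq_div_two_add (u : ℝ) :
    ∫ s : ℝ, Real.exp (-s ^ 2 / 2 + u * s) = √(2 * π) * Real.exp (u ^ 2 / 2) := by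
  have h : ∀ s : ℝ, Real.exp (-s ^ 2 / 2 + u * s)
      = Real.exp (u ^ 2 / 2) * Real.exp (-(1 / 2) * (s - u) ^ 2) := fun s => by
    rw [← Real.exp_add]
    congr 1
    ring
  simp_rw [h]
  rw [integral_const_mul, integral_sub_right_eq_self (fun s : ℝ => Real.exp (-(1 / 2) * s ^ 2)) u,
    integral_gaussian, mul_comm]
  congr 2
  ring

lemma integrable_prod_exp_neg_sq_div_two_add (u : ℝ) :
    Integrable (Function.uncurry fun t s : ℝ => Real.exp (-s ^ 2 / 2 + t * s))
      ((volume.restrict (Set.uIoc 0 u)).prod volume) := by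
  have : IsFiniteMeasure (volume.restrict (Set.uIoc 0 u)) := by
    rw [Set.uIoc]
    infer_instance
  have hb := ((integrable_exp_neg_sq_div_two_add u).add
    (integrable_exp_neg_sq_div_two_add 0)).comp_snd (volume.restrict (Set.uIoc 0 u))
  refine hb.mono' (by fun_prop) ?_
  have hm : ∀ᵐ p : ℝ × ℝ ∂((volume.restrict (Set.uIoc 0 u)).prod volume), p.1 ∈ Set.uIoc 0 u :=
    Measure.quasiMeasurePreserving_fst.ae (ae_restrict_mem measurableSet_uIoc)
  filter_upwards [hm] with p hp
  obtain ⟨t, s⟩ := p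
  have hts : t * s ≤ u * s ∨ t * s ≤ 0 * s := by
    rcases Set.mem_uIoc.1 hp with h | h <;> rcases le_total 0 s with hs | hs
    · exact Or.inl (by nlinarith)
    · exact Or.inr (by nlinarith)
    · exact Or.inr (by nlinarith)
    · exact Or.inl (by nlinarith)
  simp only [Function.uncurry, Pi.add_apply, Real.norm_eq_abs, Real.abs_exp]
  rcases hts with h | h
  · have := Real.exp_le_exp.2 (add_le_add_right h (-s ^ 2 / 2))
    have := Real.exp_pos (-s ^ 2 / 2 + 0 * s)
    linarith
  · have := Real.exp_le_exp.2 (add_le_add_right h (-s ^ 2 / 2))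
    have := Real.exp_pos (-s ^ 2 / 2 + u * s)
    linarith

lemma integrable_intervalIntegral_exp_neg_sq_div_two_add (u : ℝ) :
    Integrable fun s : ℝ => ∫ t in (0 : ℝ)..u, Real.exp (-s ^ 2 / 2 + t * s) := by
  have h := (integrable_prod_exp_neg_sq_div_two_add u).integral_prod_right
  simp_rw [intervalIntegral.intervalIntegral_eq_integral_uIoc]
  exact h.smul (if (0 : ℝ) ≤ u then (1 : ℝ) else -1)

lemma integral_intervalIntegral_exp_neg_sq_div_two_add (u : ℝ) :
    ∫ s : ℝ, ∫ t in (0 : ℝ)..u, Real.exp (-s ^ 2 / 2 + t * s)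
      = √(2 * π) * ∫ t in (0 : ℝ)..u, Real.exp (t ^ 2 / 2) := by
  rw [← intervalIntegral_integral_swap (integrable_prod_exp_neg_sq_div_two_add u)]
  simp_rw [integral_exp_neg_sq_div_two_add]
  rw [intervalIntegral.integral_const_mul]

lemma intervalIntegral_exp_neg_sq_div_two_add (u : ℝ) {s : ℝ} (hs : s ≠ 0) :
    ∫ t in (0 : ℝ)..u, Real.exp (-s ^ 2 / 2 + t * s)
      = Real.exp (-s ^ 2 / 2 + u * s) / s - Real.exp (-s ^ 2 / 2 + 0 * s) / s := by
  refine intervalIntegral.integral_eq_sub_of_hasDerivAt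
    (f := fun t => Real.exp (-s ^ 2 / 2 + t * s) / s) (fun t _ => ?_)
    (Continuous.intervalIntegrable (by fun_prop) _ _)
  have h := ((((hasDerivAt_id t).mul_const s).const_add (-s ^ 2 / 2)).exp).div_const s
  convert! h using 1
  simp [hs]

lemma integrableOn_exp_div_pow (u : ℝ) (k : ℕ) {ε : ℝ} (hε : 0 < ε) {S : Set ℝ}
    (hS : MeasurableSet S) (h : ∀ s ∈ S, ε ≤ |s|) :
    IntegrableOn (fun s : ℝ => Real.exp (-s ^ 2 / 2 + u * s) / s ^ k) S := by
  refine ((integrable_exp_neg_sq_div_two_add u).div_const (ε ^ k)).integrableOn.mono'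
    (Measurable.aestronglyMeasurable (by fun_prop)) ?_
  filter_upwards [ae_restrict_mem hS] with s hs
  rw [norm_div, norm_pow, Real.norm_eq_abs, Real.norm_eq_abs, Real.abs_exp]
  have := h s hs
  gcongr

lemma integrableOn_Ioi_exp_div_pow (u : ℝ) (k : ℕ) {ε : ℝ} (hε : 0 < ε) :
    IntegrableOn (fun s : ℝ => Real.exp (-s ^ 2 / 2 + u * s) / s ^ k) (Set.Ioi ε) :=
  integrableOn_exp_div_pow u k hε measurableSet_Ioi fun _ hs =>
    le_abs.2 (Or.inl (le_of_lt hs))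

lemma integrableOn_Iio_exp_div_pow (u : ℝ) (k : ℕ) {ε : ℝ} (hε : 0 < ε) :
    IntegrableOn (fun s : ℝ => Real.exp (-s ^ 2 / 2 + u * s) / s ^ k) (Set.Iio (-ε)) :=
  integrableOn_exp_div_pow u k hε measurableSet_Iio fun _ hs =>
    le_abs.2 (Or.inr (le_neg_of_le_neg (le_of_lt hs)))

lemma exp_div_pow_neg (u : ℝ) (k : ℕ) (s : ℝ) :
    Real.exp (-(-s) ^ 2 / 2 + u * (-s)) / (-s) ^ k
      = (-1) ^ k * (Real.exp (-s ^ 2 / 2 + (-u) * s) / s ^ k) := by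
  rw [neg_sq, neg_pow s k, mul_neg, neg_mul]
  rcases neg_one_pow_eq_or ℝ k with h | h <;> rw [h] <;> ring

lemma integral_Iio_exp_div_pow (u : ℝ) (k : ℕ) (ε : ℝ) :
    ∫ s in Set.Iio (-ε), Real.exp (-s ^ 2 / 2 + u * s) / s ^ k
      = (-1) ^ k * ∫ s in Set.Ioi ε, Real.exp (-s ^ 2 / 2 + (-u) * s) / s ^ k := by
  rw [← integral_Iic_eq_integral_Iio, ← integral_comp_neg_Ioi, ← integral_const_mul]
  simp_rw [exp_div_pow_neg]

lemma integral_Ioi_exp_div_sq (u : ℝ) {ε : ℝ} (hε : 0 < ε) :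
    ∫ s in Set.Ioi ε, Real.exp (-s ^ 2 / 2 + u * s) / s ^ 2
      = u * (∫ s in Set.Ioi ε, Real.exp (-s ^ 2 / 2 + u * s) / s ^ 1)
        - (∫ s in Set.Ioi ε, Real.exp (-s ^ 2 / 2 + u * s))
        + Real.exp (-ε ^ 2 / 2 + u * ε) / ε := by
  have i0 := (integrable_exp_neg_sq_div_two_add u).integrableOn (s := Set.Ioi ε)
  have i1 := integrableOn_Ioi_exp_div_pow u 1 hε
  have i2 := integrableOn_Ioi_exp_div_pow u 2 hε
  have hd : ∀ s ∈ Set.Ici ε, HasDerivAt (fun s : ℝ => Real.exp (-s ^ 2 / 2 + u * s) / s ^ 1)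
      (u * (Real.exp (-s ^ 2 / 2 + u * s) / s ^ 1) - Real.exp (-s ^ 2 / 2 + u * s)
        - Real.exp (-s ^ 2 / 2 + u * s) / s ^ 2) s := fun s hs => by
    have hs0 : s ≠ 0 := (hε.trans_le hs).ne'
    have h := (((((hasDerivAt_id s).pow 2).neg.div_const 2).add
      ((hasDerivAt_id s).const_mul u)).exp).div ((hasDerivAt_id s).pow 1) (by simpa using hs0)
    convert! h using 1
    simp
    field_simp
    ring
  have hi := ((i1.const_mul u).sub i0).sub i2
  have ht := tendsto_zero_of_hasDerivAt_of_integrableOn_Ioi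
    (fun s hs => hd s (Set.Ioi_subset_Ici_self hs)) hi i1
  have h := integral_Ioi_of_hasDerivAt_of_tendsto' hd hi ht
  have e : ∫ s in Set.Ioi ε, (u * (Real.exp (-s ^ 2 / 2 + u * s) / s ^ 1)
        - Real.exp (-s ^ 2 / 2 + u * s) - Real.exp (-s ^ 2 / 2 + u * s) / s ^ 2)
      = u * (∫ s in Set.Ioi ε, Real.exp (-s ^ 2 / 2 + u * s) / s ^ 1)
        - (∫ s in Set.Ioi ε, Real.exp (-s ^ 2 / 2 + u * s))
        - ∫ s in Set.Ioi ε, Real.exp (-s ^ 2 / 2 + u * s) / s ^ 2 := by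
    refine (integral_sub ((i1.const_mul u).sub i0) i2).trans (congrArg (· - _) ?_)
    exact (integral_sub (i1.const_mul u) i0).trans (by rw [integral_const_mul])
  rw [e] at h
  simp only [pow_one] at h ⊢
  linarith

lemma hasDerivAt_arc (ε θ : ℝ) :
    HasDerivAt (fun t : ℝ => (ε : ℂ) * Complex.exp (I * t))
      (I * ((ε : ℂ) * Complex.exp (I * θ))) θ := by
  have h := (((hasDerivAt_id (θ : ℂ)).const_mul I).cexp.const_mul (ε : ℂ)).comp_ofReal
  convert! h using 1
  simp
  ring

lemma exp_I_mul_pi : Complex.exp (I * (π : ℝ)) = -1 := by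
  rw [mul_comm, Complex.exp_pi_mul_I]

lemma integral_arc_of_differentiable {f : ℂ → ℂ} (hf : Differentiable ℂ f) (ε : ℝ) {b : ℝ}
    (hb : Complex.exp (I * b) = 1) :
    ∫ θ in (π : ℝ)..b, I * ((ε : ℂ) * Complex.exp (I * θ)) * f ((ε : ℂ) * Complex.exp (I * θ))
      = ∫ s in (-ε)..ε, f (s : ℂ) := by
  obtain ⟨F, hF⟩ := hf.isExactOn_univ
  have hc := hf.continuous
  have h1 := intervalIntegral.integral_eq_sub_of_hasDerivAt (a := π) (b := b)
    (f := fun θ : ℝ => F ((ε : ℂ) * Complex.exp (I * θ)))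
    (f' := fun θ : ℝ => I * ((ε : ℂ) * Complex.exp (I * θ)) *
      f ((ε : ℂ) * Complex.exp (I * θ)))
    (fun θ _ => by
      have := (hF _ trivial).comp_of_eq θ (hasDerivAt_arc ε θ) rfl
      convert! this using 1
      ring)
    (Continuous.intervalIntegrable (by fun_prop) _ _)
  have h2 := intervalIntegral.integral_eq_sub_of_hasDerivAt (a := -ε) (b := ε)
    (f := fun s : ℝ => F s) (f' := fun s : ℝ => f s)
    (fun s _ => (hF _ trivial).comp_ofReal)
    (Continuous.intervalIntegrable (by fun_prop) _ _)
  rw [h1, h2, hb, exp_I_mul_pi]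
  simp

lemma integral_Iio_add_interval_add_Ioi {f : ℝ → ℝ} (hf : Integrable f) (a b : ℝ) :
    (∫ s in Set.Iio a, f s) + (∫ s in a..b, f s) + (∫ s in Set.Ioi b, f s) = ∫ s, f s := by
  rw [← integral_Iic_eq_integral_Iio, add_assoc,
    intervalIntegral.integral_interval_add_Ioi hf.integrableOn hf.integrableOn,
    intervalIntegral.integral_Iic_add_Ioi hf.integrableOn hf.integrableOn]

lemma dslope_cexp_ofReal (u : ℝ) {s : ℝ} (hs : s ≠ 0) :
    dslope (fun z : ℂ => Complex.exp (-z ^ 2 / 2 + u * z)) 0 s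
      = (((Real.exp (-s ^ 2 / 2 + u * s) - 1) / s : ℝ) : ℂ) := by
  rw [dslope_of_ne _ (by exact_mod_cast hs), slope_def_field]
  simp

lemma differentiable_dslope_cexp (u : ℝ) :
    Differentiable ℂ (dslope (fun z : ℂ => Complex.exp (-z ^ 2 / 2 + u * z)) 0) := by
  rw [← differentiableOn_univ, Complex.differentiableOn_dslope Filter.univ_mem]
  fun_prop

lemma intervalIntegrable_exp_sub_one_div (u a b : ℝ) :
    IntervalIntegrable (fun s : ℝ => (Real.exp (-s ^ 2 / 2 + u * s) - 1) / s) volume a b := by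
  have hc := (differentiable_dslope_cexp u).continuous
  have hi : IntervalIntegrable (fun s : ℝ =>
      (dslope (fun z : ℂ => Complex.exp (-z ^ 2 / 2 + u * z)) 0 s).re) volume a b :=
    Continuous.intervalIntegrable (by fun_prop) _ _
  refine hi.congr_ae (ae_restrict_of_ae ?_)
  filter_upwards [(Set.countable_singleton (0 : ℝ)).ae_notMem volume] with s hs
  rw [dslope_cexp_ofReal u hs, Complex.ofReal_re]

lemma integral_arc_cexp (u ε : ℝ) {b : ℝ} (hb : Complex.exp (I * b) = 1) :
    ∫ θ in (π : ℝ)..b, I * Complex.exp (-((ε : ℂ) * Complex.exp (I * θ)) ^ 2 / 2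
        + u * ((ε : ℂ) * Complex.exp (I * θ)))
      = (b - π) * I
        + ((∫ s in (-ε)..ε, (Real.exp (-s ^ 2 / 2 + u * s) - 1) / s : ℝ) : ℂ) := by
  set h := dslope (fun z : ℂ => Complex.exp (-z ^ 2 / 2 + u * z)) 0 with hh
  have hd : Differentiable ℂ h := differentiable_dslope_cexp u
  have hc := hd.continuous
  have e : ∀ z : ℂ, I * Complex.exp (-z ^ 2 / 2 + u * z) = I + I * z * h z := fun z => by
    have := sub_smul_dslope (fun z : ℂ => Complex.exp (-z ^ 2 / 2 + u * z)) 0 z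
    simp only [sub_zero, smul_eq_mul] at this
    rw [mul_assoc, hh, this]
    simp
    ring
  simp_rw [e]
  rw [intervalIntegral.integral_add (Continuous.intervalIntegrable (by fun_prop) _ _)
    (Continuous.intervalIntegrable (by fun_prop) _ _), integral_arc_of_differentiable hd ε hb,
    intervalIntegral.integral_const, ← intervalIntegral.integral_ofReal]
  congr 1
  · simp
  · refine intervalIntegral.integral_congr_ae ?_
    filter_upwards [(Set.countable_singleton (0 : ℝ)).ae_notMem volume] with s hs _
    exact dslope_cexp_ofReal u hs

lemma integral_interval_exp_neg_sq_sub_one_div (ε : ℝ) :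
    ∫ s in (-ε)..ε, (Real.exp (-s ^ 2 / 2 + 0 * s) - 1) / s = 0 := by
  have h := intervalIntegral.integral_comp_neg (a := -ε) (b := ε)
    (fun s : ℝ => (Real.exp (-s ^ 2 / 2 + 0 * s) - 1) / s)
  simp only [neg_sq, zero_mul, div_neg, intervalIntegral.integral_neg, neg_neg] at h ⊢
  linarith

lemma integral_exp_div_principal_value (u : ℝ) {ε : ℝ} (hε : 0 < ε) :
    (∫ s in Set.Iio (-ε), Real.exp (-s ^ 2 / 2 + u * s) / s ^ 1)
      + (∫ s in (-ε)..ε, (Real.exp (-s ^ 2 / 2 + u * s) - 1) / s)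
      + (∫ s in Set.Ioi ε, Real.exp (-s ^ 2 / 2 + u * s) / s ^ 1)
      = √(2 * π) * ∫ t in (0 : ℝ)..u, Real.exp (t ^ 2 / 2) := by
  have hG := integrable_intervalIntegral_exp_neg_sq_div_two_add u
  have h1 : ∫ s in Set.Iio (-ε), Real.exp (-s ^ 2 / 2 + u * s) / s ^ 1
      = (∫ s in Set.Iio (-ε), ∫ t in (0 : ℝ)..u, Real.exp (-s ^ 2 / 2 + t * s))
        + ∫ s in Set.Iio (-ε), Real.exp (-s ^ 2 / 2 + 0 * s) / s ^ 1 := by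
    rw [← integral_add hG.integrableOn (integrableOn_Iio_exp_div_pow 0 1 hε)]
    refine setIntegral_congr_fun measurableSet_Iio fun s hs => ?_
    have hs' : s < -ε := hs
    simp only [intervalIntegral_exp_neg_sq_div_two_add u (show s ≠ 0 by linarith), pow_one]
    ring
  have h2 : ∫ s in Set.Ioi ε, Real.exp (-s ^ 2 / 2 + u * s) / s ^ 1
      = (∫ s in Set.Ioi ε, ∫ t in (0 : ℝ)..u, Real.exp (-s ^ 2 / 2 + t * s))
        + ∫ s in Set.Ioi ε, Real.exp (-s ^ 2 / 2 + 0 * s) / s ^ 1 := by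
    rw [← integral_add hG.integrableOn (integrableOn_Ioi_exp_div_pow 0 1 hε)]
    refine setIntegral_congr_fun measurableSet_Ioi fun s hs => ?_
    have hs' : ε < s := hs
    simp only [intervalIntegral_exp_neg_sq_div_two_add u (show s ≠ 0 by linarith), pow_one]
    ring
  have h3 : ∫ s in (-ε)..ε, (Real.exp (-s ^ 2 / 2 + u * s) - 1) / s
      = (∫ s in (-ε)..ε, ∫ t in (0 : ℝ)..u, Real.exp (-s ^ 2 / 2 + t * s))
        + ∫ s in (-ε)..ε, (Real.exp (-s ^ 2 / 2 + 0 * s) - 1) / s := by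
    rw [← intervalIntegral.integral_add hG.intervalIntegrable
      (intervalIntegrable_exp_sub_one_div 0 _ _)]
    refine intervalIntegral.integral_congr_ae ?_
    filter_upwards [(Set.countable_singleton (0 : ℝ)).ae_notMem volume] with s hs _
    rw [intervalIntegral_exp_neg_sq_div_two_add u hs]
    ring
  have h4 := integral_Iio_exp_div_pow 0 1 ε
  rw [integral_interval_exp_neg_sq_sub_one_div] at h3
  rw [neg_zero] at h4
  rw [h1, h2, h3, h4, ← integral_intervalIntegral_exp_neg_sq_div_two_add,
    ← integral_Iio_add_interval_add_Ioi hG (-ε) ε]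
  ring

lemma integral_exp_div_add_arc (u : ℝ) {ε : ℝ} (hε : 0 < ε) {b : ℝ}
    (hb : Complex.exp (I * b) = 1) :
    ((∫ s in Set.Iio (-ε), Real.exp (-s ^ 2 / 2 + u * s) / s ^ 1 : ℝ) : ℂ)
      + (∫ θ in (π : ℝ)..b, I * Complex.exp (-((ε : ℂ) * Complex.exp (I * θ)) ^ 2 / 2
          + u * ((ε : ℂ) * Complex.exp (I * θ))))
      + ((∫ s in Set.Ioi ε, Real.exp (-s ^ 2 / 2 + u * s) / s ^ 1 : ℝ) : ℂ)
      = (b - π) * I + (√(2 * π) : ℂ) * ((∫ t in (0 : ℝ)..u, Real.exp (t ^ 2 / 2) : ℝ) : ℂ) := by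
  rw [integral_arc_cexp u ε hb, ← Complex.ofReal_mul,
    ← integral_exp_div_principal_value u hε]
  push_cast
  ring

lemma integral_arc_cexp_div (u : ℝ) {ε : ℝ} (hε : ε ≠ 0) {b : ℝ}
    (hb : Complex.exp (I * b) = 1) :
    ∫ θ in (π : ℝ)..b, I * (ε : ℂ)⁻¹ * Complex.exp (-I * θ) *
        Complex.exp (-((ε : ℂ) * Complex.exp (I * θ)) ^ 2 / 2
          + u * ((ε : ℂ) * Complex.exp (I * θ)))
      = u * (∫ θ in (π : ℝ)..b, I * Complex.exp (-((ε : ℂ) * Complex.exp (I * θ)) ^ 2 / 2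
          + u * ((ε : ℂ) * Complex.exp (I * θ))))
        - ((∫ s in (-ε)..ε, Real.exp (-s ^ 2 / 2 + u * s) : ℝ) : ℂ)
        - ((Real.exp (-ε ^ 2 / 2 + u * ε) / ε + Real.exp (-ε ^ 2 / 2 + (-u) * ε) / ε : ℝ) : ℂ) := by
  have hε' : (ε : ℂ) ≠ 0 := by exact_mod_cast hε
  have h0 := integral_arc_of_differentiable
    (f := fun z : ℂ => Complex.exp (-z ^ 2 / 2 + u * z)) (by fun_prop) ε hb
  have hs : ∫ s in (-ε)..ε, Complex.exp (-(s : ℂ) ^ 2 / 2 + u * s)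
      = ((∫ s in (-ε)..ε, Real.exp (-s ^ 2 / 2 + u * s) : ℝ) : ℂ) := by
    rw [← intervalIntegral.integral_ofReal]
    push_cast
    rfl
  have h1 := intervalIntegral.integral_eq_sub_of_hasDerivAt (a := π) (b := b)
    (f := fun θ : ℝ => (ε : ℂ)⁻¹ * Complex.exp (-I * θ) *
        Complex.exp (-((ε : ℂ) * Complex.exp (I * θ)) ^ 2 / 2
          + u * ((ε : ℂ) * Complex.exp (I * θ))))
    (f' := fun θ : ℝ => u * (I * Complex.exp (-((ε : ℂ) * Complex.exp (I * θ)) ^ 2 / 2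
          + u * ((ε : ℂ) * Complex.exp (I * θ))))
        - I * ((ε : ℂ) * Complex.exp (I * θ)) *
          Complex.exp (-((ε : ℂ) * Complex.exp (I * θ)) ^ 2 / 2
          + u * ((ε : ℂ) * Complex.exp (I * θ)))
        - I * (ε : ℂ)⁻¹ * Complex.exp (-I * θ) *
          Complex.exp (-((ε : ℂ) * Complex.exp (I * θ)) ^ 2 / 2
          + u * ((ε : ℂ) * Complex.exp (I * θ))))
    (fun θ _ => by
      have hw := hasDerivAt_arc ε θ
      have hinv : HasDerivAt (fun t : ℝ => Complex.exp (-I * t))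
          (-I * Complex.exp (-I * θ)) θ := by
        have h := (((hasDerivAt_id (θ : ℂ)).const_mul (-I)).cexp).comp_ofReal
        convert! h using 1
        simp
        ring
      have h := (hinv.const_mul (ε : ℂ)⁻¹).mul
        (((hw.pow 2).neg.div_const 2).add (hw.const_mul (u : ℂ))).cexp
      convert! h using 1
      have hm : Complex.exp (-I * θ) = (Complex.exp (I * θ))⁻¹ := by
        rw [neg_mul, Complex.exp_neg]
      have hne := Complex.exp_ne_zero (I * θ)
      simp only [hm]
      simp
      field_simp
      ring)
    (Continuous.intervalIntegrable (by fun_prop) _ _)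
  rw [intervalIntegral.integral_sub (Continuous.intervalIntegrable (by fun_prop) _ _)
      (Continuous.intervalIntegrable (by fun_prop) _ _),
    intervalIntegral.integral_sub (Continuous.intervalIntegrable (by fun_prop) _ _)
      (Continuous.intervalIntegrable (by fun_prop) _ _),
    intervalIntegral.integral_const_mul, h0, hs] at h1
  have hb' : Complex.exp (-I * b) = 1 := by rw [neg_mul, Complex.exp_neg, hb, inv_one]
  have hp' : Complex.exp (-I * (π : ℝ)) = -1 := by
    rw [neg_mul, Complex.exp_neg, exp_I_mul_pi]
    norm_num
  rw [hb, hb', exp_I_mul_pi, hp'] at h1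
  push_cast at h1 ⊢
  simp only [mul_neg, mul_one, neg_mul, neg_sq] at h1 ⊢
  linear_combination -h1

lemma integral_exp_div_sq_add_arc (u : ℝ) {ε : ℝ} (hε : 0 < ε) {b : ℝ}
    (hb : Complex.exp (I * b) = 1) :
    ((∫ s in Set.Iio (-ε), Real.exp (-s ^ 2 / 2 + u * s) / s ^ 2 : ℝ) : ℂ)
      + (∫ θ in (π : ℝ)..b, I * (ε : ℂ)⁻¹ * Complex.exp (-I * θ) *
          Complex.exp (-((ε : ℂ) * Complex.exp (I * θ)) ^ 2 / 2
            + u * ((ε : ℂ) * Complex.exp (I * θ))))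
      + ((∫ s in Set.Ioi ε, Real.exp (-s ^ 2 / 2 + u * s) / s ^ 2 : ℝ) : ℂ)
      = u * ((b - π) * I
          + (√(2 * π) : ℂ) * ((∫ t in (0 : ℝ)..u, Real.exp (t ^ 2 / 2) : ℝ) : ℂ))
        - (√(2 * π) : ℂ) * (Real.exp (u ^ 2 / 2) : ℂ) := by
  have hI := integral_Iio_exp_div_pow u 0 ε
  simp only [pow_zero, div_one, one_mul] at hI
  rw [integral_arc_cexp_div u hε.ne' hb, ← integral_exp_div_add_arc u hε hb,
    ← Complex.ofReal_mul (√(2 * π)), ← integral_exp_neg_sq_div_two_add,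
    ← integral_Iio_add_interval_add_Ioi (integrable_exp_neg_sq_div_two_add u) (-ε) ε,
    integral_Iio_exp_div_pow, integral_Iio_exp_div_pow, hI, integral_Ioi_exp_div_sq u hε,
    integral_Ioi_exp_div_sq (-u) hε]
  push_cast
  ring

lemma arc_integrand_eq (u ε θ : ℝ) :
    Complex.exp (-(ε : ℂ) ^ 2 * Complex.exp (2 * I * θ) / 2 + (u : ℂ) * ε * Complex.exp (I * θ))
      = Complex.exp (-((ε : ℂ) * Complex.exp (I * θ)) ^ 2 / 2
          + u * ((ε : ℂ) * Complex.exp (I * θ))) := by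
  rw [mul_pow, ← Complex.exp_nat_mul (I * θ) 2]
  congr 1
  push_cast
  ring_nf

lemma neg_inv_two_pi_I_mul_sqrt (c x : ℂ) :
    -(1 / (2 * (π : ℂ) * I)) * (c * (π * I) + (√(2 * π) : ℂ) * x)
      = -c / 2 + I / (√(2 * π) : ℂ) * x := by
  have hs : (√(2 * π) : ℂ) ^ 2 = 2 * π := by
    rw [← Complex.ofReal_pow, Real.sq_sqrt (by positivity)]
    push_cast
    rfl
  have hs0 : (√(2 * π) : ℂ) ≠ 0 := by
    exact_mod_cast (Real.sqrt_pos.2 (by positivity)).ne'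
  have hp : (π : ℂ) = (√(2 * π) : ℂ) ^ 2 / 2 := by rw [hs]; ring
  generalize (√(2 * π) : ℂ) = r at hp hs0
  rw [hp, one_div, mul_inv, Complex.inv_I]
  field_simp
  linear_combination (c * r) * I_sq

/-- closed forms `φ_{±,0} = ±½ + (i/√(2π))∫₀^{ũ₁} e^{s²/2} ds` and
`φ_{±,1} = ±ũ₁/2 + (i/√(2π))(ũ₁∫₀^{ũ₁} e^{s²/2} ds − e^{ũ₁²/2})`. -/
theorem stmt13 (u : ℝ) (ε : ℝ) (hε : 0 < ε) :
    phiP u 0 ε = 1 / 2 + (I / (Real.sqrt (2 * π) : ℂ)) *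
      ((∫ s in (0 : ℝ)..u, Real.exp (s ^ 2 / 2) : ℝ) : ℂ) ∧
    phiM u 0 ε = -(1 / 2) + (I / (Real.sqrt (2 * π) : ℂ)) *
      ((∫ s in (0 : ℝ)..u, Real.exp (s ^ 2 / 2) : ℝ) : ℂ) ∧
    phiP u 1 ε = (u : ℂ) / 2 + (I / (Real.sqrt (2 * π) : ℂ)) *
      ((u : ℂ) * ((∫ s in (0 : ℝ)..u, Real.exp (s ^ 2 / 2) : ℝ) : ℂ)
        - (Real.exp (u ^ 2 / 2) : ℂ)) ∧
    phiM u 1 ε = -((u : ℂ) / 2) + (I / (Real.sqrt (2 * π) : ℂ)) *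
      ((u : ℂ) * ((∫ s in (0 : ℝ)..u, Real.exp (s ^ 2 / 2) : ℝ) : ℂ)
        - (Real.exp (u ^ 2 / 2) : ℂ)) := by
  have hb0 : Complex.exp (I * (0 : ℝ)) = 1 := by simp
  have hb2 : Complex.exp (I * (2 * π : ℝ)) = 1 := by
    rw [mul_comm]
    push_cast
    exact Complex.exp_two_pi_mul_I
  have hP0 := integral_exp_div_add_arc u hε hb0
  have hM0 := integral_exp_div_add_arc u hε hb2
  have hP1 := integral_exp_div_sq_add_arc u hε hb0
  have hM1 := integral_exp_div_sq_add_arc u hε hb2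
  simp only [phiP, phiM, arc_integrand_eq, Nat.cast_zero, Nat.cast_one, neg_zero, zpow_zero,
    zpow_neg_one, mul_one, mul_zero, zero_mul, Complex.exp_zero, zero_add, Nat.reduceAdd]
  rw [hP0, hM0, hP1, hM1]
  refine ⟨?_, ?_, ?_, ?_⟩
  · convert! neg_inv_two_pi_I_mul_sqrt (-1) _ using 2 <;> push_cast <;> ring
  · convert! neg_inv_two_pi_I_mul_sqrt 1 _ using 2 <;> push_cast <;> ring
  · convert! neg_inv_two_pi_I_mul_sqrt (-u) _ using 2 <;> push_cast <;> ring
  · convert! neg_inv_two_pi_I_mul_sqrt u _ using 2 <;> push_cast <;> ring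

end
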